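/- In the setting of the preceding variance bound for the standard finite-difference method (f(·, ω) differentiable with L_f-Lipschitz gradient P-a.e., E_ω[f(x, ω)] = F(x) for all x, F differentiable with L_F-Lipschitz gradient, L_F ≤ L_f, and E_ω‖∇f(x, ω) − ∇F(x)‖² ≤ β₁·‖∇F(x)‖² + β₂ with β₁, β₂ ≥ 0): for any θ > 0 and ε' > 0, if ‖∇^{FD}F(x)‖² > ε', then ⌈ E_ω‖∇^{FD}f(·, ω)(x) − ∇^{FD}F(x)‖² / (θ²·‖∇^{FD}F(x)‖²) ⌉ ≤ (1 + 4β₁/θ²) + ( (2 + β₁)·L_f²·ν²·d + 2β₂ ) / (θ²·ε'). Hence the sample size chosen by the theoretical norm condition is bounded by b₁ + b₂/ε' with b₁ = 1 + 4β₁/θ² and b₂ = ((2 + β₁)·L_f²·ν²·d + 2β₂)/θ². -/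

import Mathlib

open MeasureTheory

/-- The forward finite-difference gradient estimator
`∇^{FD}F(x) := ∑ⱼ ((F(x + ν eⱼ) − F(x))/ν) eⱼ`. -/
noncomputable def fdGrad {d : ℕ} (F : EuclideanSpace ℝ (Fin d) → ℝ) (ν : ℝ)
    (x : EuclideanSpace ℝ (Fin d)) : EuclideanSpace ℝ (Fin d) :=
  ∑ j, ((F (x + ν • EuclideanSpace.single j (1 : ℝ)) - F x) / ν) •
    EuclideanSpace.single j (1 : ℝ)

lemma hasDerivAt_line {E : Type*} [NormedAddCommGroup E] [InnerProductSpace ℝ E] [CompleteSpace E]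
    {h : E → ℝ} (hd : Differentiable ℝ h) (x v : E) (s : ℝ) :
    HasDerivAt (fun s : ℝ => h (x + s • v)) (inner ℝ (gradient h (x + s • v)) v) s := by
  have h1 : HasDerivAt (fun s : ℝ => x + s • v) v s := by
    simpa using ((hasDerivAt_id s).smul_const v).const_add x
  have h2 := (hd (x + s • v)).hasGradientAt.hasFDerivAt.comp_hasDerivAt s h1
  rw [← InnerProductSpace.toDual_apply_apply]
  exact h2

/-- If the gradient deviation along a segment is dominated by a quadratic, the linearisation
error is at most the integral of that quadratic. -/
lemma abs_sub_sub_inner_gradient_le {E : Type*} [NormedAddCommGroup E] [InnerProductSpace ℝ E]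
    [CompleteSpace E] {h : E → ℝ} {L : ℝ} (hd : Differentiable ℝ h)
    (hL : ∀ x y, ‖gradient h x - gradient h y‖ ≤ L * ‖x - y‖) (x v z : E) (a b c : ℝ)
    (hbd : ∀ s ∈ Set.Icc (0 : ℝ) 1, L * ‖x + s • v - z‖ * ‖v‖ ≤ a + b * s + c * s ^ 2) :
    |h (x + v) - h x - inner ℝ (gradient h z) v| ≤ a + b / 2 + c / 3 := by
  have hder : ∀ s : ℝ, HasDerivAt
      (fun s : ℝ => h (x + s • v) - h x - s * inner ℝ (gradient h z) v)
      (inner ℝ (gradient h (x + s • v) - gradient h z) v) s := by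
    intro s
    have := ((hasDerivAt_line hd x v s).sub_const (h x)).sub
      ((hasDerivAt_id s).mul_const (inner ℝ (gradient h z) v))
    rw [inner_sub_left]
    rw [one_mul] at this
    exact this
  have hB : ∀ s : ℝ, HasDerivAt (fun s : ℝ => a * s + b / 2 * s ^ 2 + c / 3 * s ^ 3)
      (a + b * s + c * s ^ 2) s := by
    intro s
    have := (((hasDerivAt_id s).const_mul a).add ((hasDerivAt_pow 2 s).const_mul (b / 2))).add
      ((hasDerivAt_pow 3 s).const_mul (c / 3))
    refine this.congr_deriv ?_
    norm_num
    ring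
  have key := image_norm_le_of_norm_deriv_right_le_deriv_boundary (a := 0) (b := 1)
    (fun s _ => (hder s).continuousAt.continuousWithinAt)
    (fun s _ => (hder s).hasDerivWithinAt) (by simp) hB
    (fun s hs => by
      refine (norm_inner_le_norm _ _).trans (le_trans ?_ (hbd s ⟨hs.1, hs.2.le⟩))
      exact mul_le_mul_of_nonneg_right (hL _ _) (norm_nonneg _))
    (Set.right_mem_Icc.2 zero_le_one)
  simpa [Real.norm_eq_abs] using key

lemma fdGrad_apply {d : ℕ} (F : EuclideanSpace ℝ (Fin d) → ℝ) (ν : ℝ)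
    (x : EuclideanSpace ℝ (Fin d)) (k : Fin d) :
    fdGrad F ν x k = (F (x + ν • EuclideanSpace.single k (1 : ℝ)) - F x) / ν := by
  simp [fdGrad, Pi.single_apply]

lemma abs_fdGrad_sub_gradient_apply_le {d : ℕ} {h : EuclideanSpace ℝ (Fin d) → ℝ} {L : ℝ}
    (hd : Differentiable ℝ h) (hL : ∀ x y, ‖gradient h x - gradient h y‖ ≤ L * ‖x - y‖)
    (hL0 : 0 ≤ L) {ν : ℝ} (hν : 0 < ν) (x z : EuclideanSpace ℝ (Fin d)) (k : Fin d) (a b c : ℝ)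
    (hbd : ∀ s ∈ Set.Icc (0 : ℝ) 1,
      ‖x + (s * ν) • EuclideanSpace.single k (1 : ℝ) - z‖ ≤ ν * (a + b * s + c * s ^ 2)) :
    |fdGrad h ν x k - gradient h z k| ≤ L * ν * (a + b / 2 + c / 3) := by
  have key := abs_sub_sub_inner_gradient_le hd hL x (ν • EuclideanSpace.single k (1 : ℝ)) z
    (L * ν ^ 2 * a) (L * ν ^ 2 * b) (L * ν ^ 2 * c) (fun s hs => by
      have h1 := mul_le_mul_of_nonneg_left (hbd s hs) (mul_nonneg hL0 hν.le)
      simp only [smul_smul, norm_smul, PiLp.norm_single, Real.norm_eq_abs, abs_one,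
        abs_of_pos hν]
      nlinarith)
  have h2 : inner ℝ (gradient h z) (ν • EuclideanSpace.single k (1 : ℝ))
      = ν * gradient h z k := by
    rw [inner_smul_right, EuclideanSpace.inner_single_right]
    simp
  rw [h2] at key
  rw [fdGrad_apply]
  have h3 : (h (x + ν • EuclideanSpace.single k (1 : ℝ)) - h x) / ν - gradient h z k
      = (h (x + ν • EuclideanSpace.single k (1 : ℝ)) - h x - ν * gradient h z k) / ν := by
    field_simp
  rw [h3, abs_div, abs_of_pos hν, div_le_iff₀ hν]
  linarith

lemma norm_le_sqrt_card_mul {d : ℕ} {w : EuclideanSpace ℝ (Fin d)} {c : ℝ} (hc : 0 ≤ c)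
    (hw : ∀ k, |w k| ≤ c) : ‖w‖ ≤ √d * c := by
  rw [EuclideanSpace.norm_eq]
  apply Real.sqrt_le_iff.2 ⟨by positivity, ?_⟩
  rw [mul_pow, Real.sq_sqrt (Nat.cast_nonneg d)]
  calc ∑ k, ‖w k‖ ^ 2 ≤ ∑ _k : Fin d, c ^ 2 :=
        Finset.sum_le_sum fun k _ => pow_le_pow_left₀ (norm_nonneg _) (hw k) 2
    _ = d * c ^ 2 := by simp

lemma norm_fdGrad_sub_gradient_le {d : ℕ} {h : EuclideanSpace ℝ (Fin d) → ℝ} {L : ℝ}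
    (hd : Differentiable ℝ h) (hL : ∀ x y, ‖gradient h x - gradient h y‖ ≤ L * ‖x - y‖)
    (hL0 : 0 ≤ L) {ν : ℝ} (hν : 0 < ν) (x : EuclideanSpace ℝ (Fin d)) :
    ‖fdGrad h ν x - gradient h x‖ ≤ √d * (L * ν / 2) := by
  refine norm_le_sqrt_card_mul (by positivity) fun k => ?_
  have := abs_fdGrad_sub_gradient_apply_le hd hL hL0 hν x x k 0 1 0 (fun s hs => by
    simp [norm_smul, abs_of_pos hν, abs_of_nonneg hs.1, mul_comm])
  simpa [div_eq_mul_inv] using this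

lemma sqrt_sq_add_sq_le {s t : ℝ} (hs : s ∈ Set.Icc (0 : ℝ) 1) (ht : t ∈ Set.Icc (0 : ℝ) 1) :
    √(s ^ 2 + t ^ 2) ≤ t + (1 - t) * s + t / 2 * s ^ 2 := by
  obtain ⟨hs0, hs1⟩ := hs
  obtain ⟨ht0, ht1⟩ := ht
  have hq : 0 ≤ 1 - s + s ^ 2 / 2 := by nlinarith
  apply Real.sqrt_le_iff.2 ⟨by nlinarith [mul_nonneg ht0 hq], ?_⟩
  have h1 : 0 ≤ s * t * (1 - t) := mul_nonneg (mul_nonneg hs0 ht0) (by linarith)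
  have h2 : 0 ≤ s ^ 4 * t ^ 2 := by positivity
  nlinarith [mul_nonneg h1 hq]

/-- Finite-difference error measured at a point of a coordinate ray up to which `F` vanishes. -/
lemma norm_fdGrad_sub_fdGrad_sub_gradient_le {d : ℕ} {h F : EuclideanSpace ℝ (Fin d) → ℝ} {L : ℝ}
    (hd : Differentiable ℝ h) (hL : ∀ x y, ‖gradient h x - gradient h y‖ ≤ L * ‖x - y‖)
    (hF : Differentiable ℝ F) (hLF : ∀ x y, ‖gradient F x - gradient F y‖ ≤ L * ‖x - y‖)
    (hL0 : 0 ≤ L) {ν : ℝ} (hν : 0 < ν) (x : EuclideanSpace ℝ (Fin d)) {τ : ℝ}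
    (hτ : τ ∈ Set.Icc (0 : ℝ) 1) (hFx : F x = 0)
    (hF0 : ∀ k, F (x + (τ * ν) • EuclideanSpace.single k (1 : ℝ)) = 0)
    (hG0 : ∀ k, gradient F (x + (τ * ν) • EuclideanSpace.single k (1 : ℝ)) = 0) (j : Fin d) :
    ‖fdGrad h ν x - fdGrad F ν x
      - gradient h (x + (τ * ν) • EuclideanSpace.single j (1 : ℝ))‖ ≤ √d * (L * ν) := by
  obtain ⟨ht0, ht1⟩ := id hτ
  have hLν : 0 ≤ L * ν := by positivity
  have hFk : ∀ k, |fdGrad F ν x k| ≤ L * ν * ((1 - τ) ^ 2 / 2) := by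
    intro k
    have key := abs_sub_sub_inner_gradient_le hF hLF
      (x + (τ * ν) • EuclideanSpace.single k (1 : ℝ))
      (((1 - τ) * ν) • EuclideanSpace.single k (1 : ℝ))
      (x + (τ * ν) • EuclideanSpace.single k (1 : ℝ)) 0 (L * ((1 - τ) * ν) ^ 2) 0 (fun s hs => by
        have h1 : 0 ≤ (1 - τ) * ν := mul_nonneg (by linarith) hν.le
        simp only [add_sub_cancel_left, norm_smul, PiLp.norm_single, Real.norm_eq_abs,
          abs_one, abs_of_nonneg h1, abs_of_nonneg hs.1]
        apply le_of_eq
        ring)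
    rw [add_assoc, ← add_smul, ← add_mul, add_sub_cancel, one_mul, hF0, hG0] at key
    rw [fdGrad_apply, hFx, sub_zero, abs_div, abs_of_pos hν, div_le_iff₀ hν]
    simp only [sub_zero, inner_zero_left] at key
    linarith
  rcases le_or_gt 4 d with h4 | h4
  · have hsd : (2 : ℝ) ≤ √d := by
      apply Real.le_sqrt_of_sq_le
      have : (4 : ℝ) ≤ d := by exact_mod_cast h4
      linarith
    have h1 := norm_fdGrad_sub_gradient_le hd hL hL0 hν x
    have h2 := norm_le_sqrt_card_mul (by positivity) hFk
    have h3 := hL x (x + (τ * ν) • EuclideanSpace.single j (1 : ℝ))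
    have h4 : ‖x - (x + (τ * ν) • EuclideanSpace.single j (1 : ℝ))‖ = τ * ν := by
      simp [norm_smul, abs_of_pos hν, abs_of_nonneg ht0]
    rw [h4] at h3
    have h5 : fdGrad h ν x - fdGrad F ν x
        - gradient h (x + (τ * ν) • EuclideanSpace.single j (1 : ℝ))
        = (fdGrad h ν x - gradient h x) + (gradient h x
          - gradient h (x + (τ * ν) • EuclideanSpace.single j (1 : ℝ))) - fdGrad F ν x := by
      abel
    rw [h5]
    refine (norm_sub_le _ _).trans ((add_le_add (norm_add_le _ _) le_rfl).trans ?_)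
    have h6 : √d / 2 + τ + √d * ((1 - τ) ^ 2 / 2) ≤ √d := by
      nlinarith [mul_nonneg ht0 (sub_nonneg.2 ht1),
        mul_nonneg (sub_nonneg.2 hsd) (mul_nonneg ht0 (by linarith : 0 ≤ 2 - τ))]
    nlinarith [mul_le_mul_of_nonneg_left h6 hLν]
  · set z := x + (τ * ν) • EuclideanSpace.single j (1 : ℝ) with hz
    set w := fdGrad h ν x - fdGrad F ν x - gradient h z with hw
    have hwk : ∀ k, |w k| ≤ |fdGrad h ν x k - gradient h z k| + |fdGrad F ν x k| := by
      intro k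
      have : w k = (fdGrad h ν x k - gradient h z k) - fdGrad F ν x k := by
        simp only [hw, PiLp.sub_apply]
        ring
      rw [this]
      exact abs_sub _ _
    have hj : |w j| ≤ L * ν * (1 - τ / 2) := by
      have := abs_fdGrad_sub_gradient_apply_le hd hL hL0 hν x z j τ (1 - 2 * τ) 0 (fun s hs => by
        rw [hz, add_sub_add_left_eq_sub, ← sub_smul, ← sub_mul]
        simp only [norm_smul, PiLp.norm_single, Real.norm_eq_abs, abs_one, abs_mul,
          abs_of_pos hν]
        have : |s - τ| ≤ τ + (1 - 2 * τ) * s :=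
          abs_le.2 ⟨by nlinarith [hs.1, hs.2], by nlinarith [hs.1, hs.2]⟩
        nlinarith)
      refine (hwk j).trans ((add_le_add this (hFk j)).trans ?_)
      rw [← mul_add]
      apply mul_le_mul_of_nonneg_left _ hLν
      nlinarith
    have hk : ∀ k, k ≠ j → |w k| ≤ L * ν * (1 + τ / 6) := by
      intro k hkj
      have := abs_fdGrad_sub_gradient_apply_le hd hL hL0 hν x z k τ (1 - τ) (τ / 2) (fun s hs => by
        have h1 : ‖(s * ν) • EuclideanSpace.single k (1 : ℝ)
            - (τ * ν) • EuclideanSpace.single j (1 : ℝ)‖ = √(ν ^ 2 * (s ^ 2 + τ ^ 2)) := by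
          symm
          rw [Real.sqrt_eq_iff_mul_self_eq (by positivity) (norm_nonneg _), ← sq,
            @norm_sub_sq ℝ, inner_smul_left, inner_smul_right]
          simp [norm_smul, EuclideanSpace.inner_single_left, hkj, mul_pow]
          ring
        rw [hz, add_sub_add_left_eq_sub, h1, Real.sqrt_mul (by positivity),
          Real.sqrt_sq hν.le]
        exact mul_le_mul_of_nonneg_left (sqrt_sq_add_sq_le hs hτ) hν.le)
      refine (hwk k).trans ((add_le_add this (hFk k)).trans ?_)
      rw [← mul_add]
      apply mul_le_mul_of_nonneg_left _ hLν
      nlinarith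
    rw [EuclideanSpace.norm_eq]
    apply Real.sqrt_le_iff.2 ⟨by positivity, ?_⟩
    rw [mul_pow, Real.sq_sqrt (Nat.cast_nonneg d), ← Finset.add_sum_erase _ _ (Finset.mem_univ j)]
    have hsum : ∑ k ∈ Finset.univ.erase j, ‖w k‖ ^ 2
        ≤ ∑ _k ∈ Finset.univ.erase j, (L * ν * (1 + τ / 6)) ^ 2 :=
      Finset.sum_le_sum fun k hk' =>
        pow_le_pow_left₀ (norm_nonneg _) (hk k (Finset.ne_of_mem_erase hk')) 2
    have hj2 : ‖w j‖ ^ 2 ≤ (L * ν * (1 - τ / 2)) ^ 2 := pow_le_pow_left₀ (norm_nonneg _) hj 2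
    have hd1 : 1 ≤ d := Nat.succ_le_of_lt (Fin.pos j)
    rw [Finset.sum_const, Finset.card_erase_of_mem (Finset.mem_univ j), Finset.card_univ,
      Fintype.card_fin, nsmul_eq_mul, Nat.cast_sub hd1, Nat.cast_one] at hsum
    have hd3 : (d : ℝ) ≤ 3 := by exact_mod_cast Nat.lt_succ_iff.1 h4
    have h7 : (1 - τ / 2) ^ 2 + (d - 1) * (1 + τ / 6) ^ 2 ≤ (d : ℝ) := by
      nlinarith [mul_nonneg (sub_nonneg.2 hd3) (by positivity : 0 ≤ τ / 3 + τ ^ 2 / 36),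
        mul_nonneg ht0 (sub_nonneg.2 ht1)]
    nlinarith [mul_le_mul_of_nonneg_left h7 (sq_nonneg (L * ν))]

lemma integral_norm_sq_le_of_norm_sub_le {Ω E : Type*} [NormedAddCommGroup E]
    {mΩ : MeasurableSpace Ω} {P : Measure Ω} [IsProbabilityMeasure P] {u v : Ω → E} {K : ℝ}
    (hv : AEStronglyMeasurable v P) (huv : ∀ᵐ ω ∂P, ‖u ω - v ω‖ ^ 2 ≤ K) :
    ∫ ω, ‖u ω‖ ^ 2 ∂P ≤ 2 * (∫ ω, ‖v ω‖ ^ 2 ∂P) + 2 * K := by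
  have hK : 0 ≤ K := by
    obtain ⟨ω, hω⟩ := huv.exists
    exact (sq_nonneg _).trans hω
  by_cases hvi : Integrable (fun ω => ‖v ω‖ ^ 2) P
  · have h1 : ∫ ω, ‖u ω‖ ^ 2 ∂P ≤ ∫ ω, (2 * ‖v ω‖ ^ 2 + 2 * K) ∂P := by
      refine integral_mono_of_nonneg (.of_forall fun ω => by positivity)
        ((hvi.const_mul 2).add (integrable_const _)) ?_
      filter_upwards [huv] with ω hω
      have h2 := norm_le_norm_sub_add (u ω) (v ω)
      nlinarith [norm_nonneg (u ω), sq_nonneg (‖u ω - v ω‖ - ‖v ω‖)]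
    rwa [integral_add (hvi.const_mul 2) (integrable_const _), integral_const_mul,
      integral_const, probReal_univ, one_smul] at h1
  · have hui : ¬ Integrable (fun ω => ‖u ω‖ ^ 2) P := by
      intro hui
      apply hvi
      refine ((hui.const_mul 2).add (integrable_const (2 * K))).mono' (hv.norm.pow 2) ?_
      filter_upwards [huv] with ω hω
      have h2 := norm_le_norm_sub_add (v ω) (u ω)
      rw [norm_sub_rev] at h2
      simp only [Pi.add_apply, norm_pow, norm_norm]
      nlinarith [norm_nonneg (v ω), sq_nonneg (‖u ω - v ω‖ - ‖u ω‖)]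
    rw [integral_undef hui, integral_undef hvi]
    linarith

lemma aestronglyMeasurable_gradient {d : ℕ} {Ω : Type*} {mΩ : MeasurableSpace Ω} {P : Measure Ω}
    {f : EuclideanSpace ℝ (Fin d) → Ω → ℝ} {L : ℝ} (hL0 : 0 ≤ L)
    (hf : ∀ᵐ ω ∂P, Differentiable ℝ (fun y => f y ω) ∧
      ∀ x y, ‖gradient (fun z => f z ω) x - gradient (fun z => f z ω) y‖ ≤ L * ‖x - y‖)
    {U : Set (EuclideanSpace ℝ (Fin d))} (hU : IsOpen U)
    (hm : ∀ y ∈ U, AEStronglyMeasurable (f y) P) {z : EuclideanSpace ℝ (Fin d)}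
    (hz : z ∈ closure U) :
    AEStronglyMeasurable (fun ω => gradient (fun y => f y ω) z) P := by
  have hopen : ∀ y ∈ U, AEStronglyMeasurable (fun ω => gradient (fun y => f y ω) y) P := by
    intro y hy
    obtain ⟨δ, hδ, hball⟩ := Metric.isOpen_iff.1 hU y hy
    have hpos : ∀ n : ℕ, 0 < δ / 2 * (1 / ((n : ℝ) + 1)) := fun n => by positivity
    have hle : ∀ n : ℕ, δ / 2 * (1 / ((n : ℝ) + 1)) < δ := fun n => by
      have : 1 / ((n : ℝ) + 1) ≤ 1 := by
        rw [div_le_one (by positivity)]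
        linarith [(Nat.cast_nonneg n : (0 : ℝ) ≤ n)]
      nlinarith
    have hlim : Filter.Tendsto (fun n : ℕ => δ / 2 * (1 / ((n : ℝ) + 1))) Filter.atTop
        (nhds 0) := by
      simpa using (tendsto_one_div_add_atTop_nhds_zero_nat (𝕜 := ℝ)).const_mul (δ / 2)
    refine aestronglyMeasurable_of_tendsto_ae Filter.atTop
      (f := fun (n : ℕ) ω => fdGrad (fun y => f y ω) (δ / 2 * (1 / ((n : ℝ) + 1))) y) ?_ ?_
    · intro n
      unfold fdGrad
      refine Finset.aestronglyMeasurable_fun_sum _ fun k _ => ?_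
      have hmem : y + (δ / 2 * (1 / ((n : ℝ) + 1))) • EuclideanSpace.single k (1 : ℝ) ∈ U := by
        apply hball
        rw [Metric.mem_ball, dist_self_add_left, norm_smul, PiLp.norm_single, norm_one,
          mul_one, Real.norm_eq_abs, abs_of_pos (hpos n)]
        exact hle n
      simp only [div_eq_mul_inv _ (δ / 2 * (1 / ((n : ℝ) + 1)))]
      exact (((hm _ hmem).sub (hm y hy)).mul_const _).smul_const _
    · filter_upwards [hf] with ω hω
      rw [tendsto_iff_norm_sub_tendsto_zero]
      refine squeeze_zero (fun _ => norm_nonneg _)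
        (fun n => norm_fdGrad_sub_gradient_le hω.1 hω.2 hL0 (hpos n) y) ?_
      simpa using ((hlim.const_mul L).div_const 2).const_mul (√d)
  obtain ⟨y, hyU, hyz⟩ := mem_closure_iff_seq_limit.1 hz
  refine aestronglyMeasurable_of_tendsto_ae Filter.atTop
    (f := fun n ω => gradient (fun y => f y ω) (y n)) (fun n => hopen _ (hyU n)) ?_
  filter_upwards [hf] with ω hω
  rw [tendsto_iff_norm_sub_tendsto_zero] at hyz ⊢
  refine squeeze_zero (fun _ => norm_nonneg _) (fun n => hω.2 (y n) z) ?_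
  simpa using hyz.const_mul L

/-- First contact of the coordinate rays from `x` with the closure of `{F ≠ 0}`. -/
lemma exists_first_contact {d : ℕ} {F : EuclideanSpace ℝ (Fin d) → ℝ} {L : ℝ}
    (hF : Differentiable ℝ F) (hLF : ∀ x y, ‖gradient F x - gradient F y‖ ≤ L * ‖x - y‖)
    {ν : ℝ} (x : EuclideanSpace ℝ (Fin d)) (hne : fdGrad F ν x ≠ 0)
    (hx : x ∉ closure {y | F y ≠ 0}) :
    ∃ τ ∈ Set.Icc (0 : ℝ) 1, ∃ j : Fin d,
      x + (τ * ν) • EuclideanSpace.single j (1 : ℝ) ∈ closure {y | F y ≠ 0} ∧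
      ∀ k, F (x + (τ * ν) • EuclideanSpace.single k (1 : ℝ)) = 0 ∧
        gradient F (x + (τ * ν) • EuclideanSpace.single k (1 : ℝ)) = 0 := by
  have hFx : F x = 0 := by
    by_contra h
    exact hx (subset_closure h)
  set p : Fin d → ℝ → EuclideanSpace ℝ (Fin d) :=
    fun k s => x + (s * ν) • EuclideanSpace.single k (1 : ℝ) with hp
  have hpc : ∀ k, Continuous (p k) := fun k => by fun_prop
  set T : Set ℝ := Set.Icc 0 1 ∩ ⋃ k, p k ⁻¹' closure {y | F y ≠ 0} with hT
  have hTc : IsCompact T :=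
    isCompact_Icc.inter_right (isClosed_iUnion_of_finite fun k => isClosed_closure.preimage (hpc k))
  have hTn : T.Nonempty := by
    by_contra hempty
    apply hne
    ext k
    have hk : F (x + ν • EuclideanSpace.single k (1 : ℝ)) = 0 := by
      by_contra h
      refine hempty ⟨1, ⟨zero_le_one, le_rfl⟩, Set.mem_iUnion.2 ⟨k, subset_closure ?_⟩⟩
      simpa [hp] using h
    rw [fdGrad_apply, hk, hFx]
    simp
  obtain ⟨τ, ⟨hτ, hτU⟩, hmin⟩ := hTc.exists_isLeast hTn
  obtain ⟨j, hj⟩ := Set.mem_iUnion.1 hτU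
  have hτ0 : 0 < τ := by
    rcases hτ.1.eq_or_lt with h | h
    · exfalso
      apply hx
      simpa [hp, ← h] using hj
    · exact h
  have hbefore : ∀ k, ∀ s ∈ Set.Ico 0 τ, F (p k s) = 0 ∧ gradient F (p k s) = 0 := by
    intro k s hs
    have hnot : p k s ∉ closure {y | F y ≠ 0} := fun hmem =>
      (hmin ⟨⟨hs.1, hs.2.le.trans hτ.2⟩, Set.mem_iUnion.2 ⟨k, hmem⟩⟩).not_gt hs.2
    have hev : F =ᶠ[nhds (p k s)] fun _ => 0 := by
      filter_upwards [isClosed_closure.isOpen_compl.mem_nhds hnot] with y hy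
      by_contra h
      exact hy (subset_closure h)
    refine ⟨hev.eq_of_nhds, ?_⟩
    rw [gradient, hev.fderiv_eq]
    simp
  have hgc : Continuous (gradient F) := by
    refine continuous_iff_continuousAt.2 fun y => ?_
    rw [ContinuousAt, tendsto_iff_norm_sub_tendsto_zero]
    refine squeeze_zero (fun _ => norm_nonneg _) (fun y' => hLF y' y) ?_
    have : Filter.Tendsto (fun y' => ‖y' - y‖) (nhds y) (nhds 0) :=
      tendsto_iff_norm_sub_tendsto_zero.1 Filter.tendsto_id
    simpa using this.const_mul L
  refine ⟨τ, hτ, j, hj, fun k => ?_⟩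
  have hclosed : IsClosed {s | F (p k s) = 0 ∧ gradient F (p k s) = 0} :=
    (isClosed_eq (hF.continuous.comp (hpc k)) continuous_const).inter
      (isClosed_eq (hgc.comp (hpc k)) continuous_const)
  have hsub := closure_minimal (fun s hs => hbefore k s hs) hclosed
  rw [closure_Ico hτ0.ne] at hsub
  exact hsub ⟨hτ0.le, le_rfl⟩

/-- (Sample-size bound for the standard finite-difference method.)
In the FD variance-bound setting, for `θ > 0`, `ε' > 0` with `‖∇^{FD}F(x)‖² > ε'`, the
sample size chosen by the theoretical norm condition satisfies
`⌈E_ω‖∇^{FD}f(·,ω)(x) − ∇^{FD}F(x)‖² / (θ²‖∇^{FD}F(x)‖²)⌉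
  ≤ (1 + 4β₁/θ²) + ((2+β₁)L_f²ν²d + 2β₂)/(θ²ε')`, i.e. is bounded by `b₁ + b₂/ε'`. -/
theorem fd_sample_size_bound
    {d : ℕ} {Ω : Type*} {mΩ : MeasurableSpace Ω}
    (P : Measure Ω) [IsProbabilityMeasure P]
    (f : EuclideanSpace ℝ (Fin d) → Ω → ℝ) (F : EuclideanSpace ℝ (Fin d) → ℝ)
    (Lf LF β₁ β₂ : ℝ) (hβ₁ : 0 ≤ β₁) (hβ₂ : 0 ≤ β₂)
    (hf : ∀ᵐ ω ∂P, Differentiable ℝ (fun y => f y ω) ∧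
      ∀ x y, ‖gradient (fun z => f z ω) x - gradient (fun z => f z ω) y‖
        ≤ Lf * ‖x - y‖)
    (hmeanf : ∀ x, ∫ ω, f x ω ∂P = F x)
    (hF : Differentiable ℝ F)
    (hLF : ∀ x y, ‖gradient F x - gradient F y‖ ≤ LF * ‖x - y‖)
    (hLL : LF ≤ Lf)
    (hvar : ∀ x, ∫ ω, ‖gradient (fun z => f z ω) x - gradient F x‖ ^ 2 ∂P
      ≤ β₁ * ‖gradient F x‖ ^ 2 + β₂)
    (x : EuclideanSpace ℝ (Fin d)) (ν : ℝ) (hν : 0 < ν)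
    (θ ε' : ℝ) (hθ : 0 < θ) (hε' : 0 < ε')
    (hlow : ε' < ‖fdGrad F ν x‖ ^ 2) :
    ((⌈(∫ ω, ‖fdGrad (fun y => f y ω) ν x - fdGrad F ν x‖ ^ 2 ∂P) /
          (θ ^ 2 * ‖fdGrad F ν x‖ ^ 2)⌉ : ℤ) : ℝ)
      ≤ (1 + 4 * β₁ / θ ^ 2)
        + ((2 + β₁) * Lf ^ 2 * ν ^ 2 * d + 2 * β₂) / (θ ^ 2 * ε') := by
  have hB : 0 < ‖fdGrad F ν x‖ ^ 2 := hε'.trans hlow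
  have hne : fdGrad F ν x ≠ 0 := by
    intro h
    simp [h] at hB
  obtain ⟨i⟩ : Nonempty (Fin d) := by
    by_contra hempty
    rw [not_nonempty_iff] at hempty
    exact hne (Subsingleton.elim _ _)
  have hL0 : 0 ≤ Lf := by
    obtain ⟨ω, hω⟩ := hf.exists
    have := (norm_nonneg _).trans (hω.2 (EuclideanSpace.single i (1 : ℝ)) 0)
    simpa using this
  have hLF' : ∀ x y, ‖gradient F x - gradient F y‖ ≤ Lf * ‖x - y‖ := fun x y =>
    (hLF x y).trans (mul_le_mul_of_nonneg_right hLL (norm_nonneg _))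
  have hsq : ∀ c : ℝ, (√d * c) ^ 2 = d * c ^ 2 := fun c => by
    rw [mul_pow, Real.sq_sqrt (Nat.cast_nonneg d)]
  -- A point where the second-moment hypothesis carries genuine information.
  obtain ⟨z, hzU, hzF, hzf⟩ : ∃ z ∈ closure {y | F y ≠ 0},
      ‖gradient F z‖ ^ 2 ≤ 2 * ‖fdGrad F ν x‖ ^ 2 + Lf ^ 2 * ν ^ 2 * d / 2 ∧
      ∀ᵐ ω ∂P, ‖(fdGrad (fun y => f y ω) ν x - fdGrad F ν x)
        - (gradient (fun y => f y ω) z - gradient F z)‖ ^ 2 ≤ d * (Lf * ν) ^ 2 := by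
    by_cases hx : x ∈ closure {y | F y ≠ 0}
    · have hFx := norm_fdGrad_sub_gradient_le hF hLF' hL0 hν x
      refine ⟨x, hx, ?_, ?_⟩
      · have h1 := norm_le_norm_sub_add (gradient F x) (fdGrad F ν x)
        rw [norm_sub_rev] at h1
        have h2 := pow_le_pow_left₀ (norm_nonneg _) hFx 2
        rw [hsq] at h2
        nlinarith [norm_nonneg (gradient F x),
          sq_nonneg (‖fdGrad F ν x - gradient F x‖ - ‖fdGrad F ν x‖)]
      · filter_upwards [hf] with ω hω
        have h1 := norm_fdGrad_sub_gradient_le hω.1 hω.2 hL0 hν x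
        rw [← hsq, sub_sub_sub_comm]
        refine pow_le_pow_left₀ (norm_nonneg _) ((norm_sub_le _ _).trans ?_) 2
        linarith
    · obtain ⟨τ, hτ, j, hj, hk⟩ := exists_first_contact hF hLF' x hne hx
      have hFx : F x = 0 := by
        by_contra h
        exact hx (subset_closure h)
      refine ⟨_, hj, ?_, ?_⟩
      · rw [(hk j).2, norm_zero, zero_pow two_ne_zero]
        positivity
      · filter_upwards [hf] with ω hω
        rw [(hk j).2, sub_zero, ← hsq]
        exact pow_le_pow_left₀ (norm_nonneg _) (norm_fdGrad_sub_fdGrad_sub_gradient_le hω.1 hω.2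
          hF hLF' hL0 hν x hτ hFx (fun k => (hk k).1) (fun k => (hk k).2) j) 2
  have hmeas := aestronglyMeasurable_gradient hL0 hf
    (isOpen_ne_fun hF.continuous continuous_const) (fun y (hy : F y ≠ 0) => by
      by_contra h
      exact hy (by rw [← hmeanf y, integral_undef fun hi => h hi.aestronglyMeasurable])) hzU
  have hA := integral_norm_sq_le_of_norm_sub_le
    (hmeas.sub (aestronglyMeasurable_const (b := gradient F z))) hzf
  simp only [Pi.sub_apply] at hA
  have hC : 0 ≤ (2 + β₁) * Lf ^ 2 * ν ^ 2 * d + 2 * β₂ := by positivity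
  have hAB : ∫ ω, ‖fdGrad (fun y => f y ω) ν x - fdGrad F ν x‖ ^ 2 ∂P
      ≤ 4 * β₁ * ‖fdGrad F ν x‖ ^ 2 + ((2 + β₁) * Lf ^ 2 * ν ^ 2 * d + 2 * β₂) := by
    nlinarith [hvar z, mul_le_mul_of_nonneg_left hzF hβ₁]
  refine (Int.ceil_lt_add_one _).le.trans ?_
  have h1 : (∫ ω, ‖fdGrad (fun y => f y ω) ν x - fdGrad F ν x‖ ^ 2 ∂P) /
      (θ ^ 2 * ‖fdGrad F ν x‖ ^ 2) ≤ 4 * β₁ / θ ^ 2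
        + ((2 + β₁) * Lf ^ 2 * ν ^ 2 * d + 2 * β₂) / (θ ^ 2 * ‖fdGrad F ν x‖ ^ 2) := by
    rw [div_le_iff₀ (by positivity), add_mul, div_mul_cancel₀ _ (by positivity)]
    refine hAB.trans (le_of_eq ?_)
    field_simp
  have h2 : ((2 + β₁) * Lf ^ 2 * ν ^ 2 * d + 2 * β₂) / (θ ^ 2 * ‖fdGrad F ν x‖ ^ 2)
      ≤ ((2 + β₁) * Lf ^ 2 * ν ^ 2 * d + 2 * β₂) / (θ ^ 2 * ε') := by
    gcongr
  linarith
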